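/- Let N ≥ 1 be an integer and β ∈ ℂ with |β| < 1. Then for every nonzero integer k, the series Σ_{l∈ℤ} û(l)·û(k−l) converges absolutely and (1/2)·Σ_{l∈ℤ} û(l)·û(k−l) = |k|·û(k). (This expresses, in Fourier variables, that the N-hump stationary solution satisfies the stationary Benjamin–Ono equation Hu_xx − uu_x = 0.) -/

import Mathlib

open Complex

/-- Fourier coefficients of the `N`-hump stationary solution of Benjamin–Ono. -/
noncomputable def uhat (N : ℕ) (β : ℂ) (k : ℤ) : ℂ :=
  if k = 0 then (N : ℂ) * (((1 - 3 * ‖β‖ ^ 2) / (1 - ‖β‖ ^ 2) : ℝ) : ℂ)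
  else if (N : ℤ) ∣ k then
    if 0 < k then 2 * (N : ℂ) * β ^ ((k / (N : ℤ)).toNat)
    else 2 * (N : ℂ) * (starRingEnd ℂ β) ^ ((|k| / (N : ℤ)).toNat)
  else 0

/-- Rescaled coefficients (the case of one hump). -/
noncomputable def vhat (β : ℂ) (j : ℤ) : ℂ :=
  if j = 0 then (((1 - 3 * ‖β‖ ^ 2) / (1 - ‖β‖ ^ 2) : ℝ) : ℂ)
  else if 0 < j then 2 * β ^ j.toNat
  else 2 * (starRingEnd ℂ β) ^ (-j).toNat

lemma vhat_pos (β : ℂ) (n : ℕ) : vhat β ((n : ℤ) + 1) = 2 * β ^ (n + 1) := by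
  have h1 : ((n : ℤ) + 1) ≠ 0 := by omega
  have h2 : 0 < ((n : ℤ) + 1) := by omega
  have h3 : ((n : ℤ) + 1).toNat = n + 1 := by omega
  simp only [vhat, if_neg h1, if_pos h2, h3]

lemma vhat_neg (β : ℂ) (n : ℕ) :
    vhat β (-((n : ℤ) + 1)) = 2 * (starRingEnd ℂ β) ^ (n + 1) := by
  have h1 : (-((n : ℤ) + 1)) ≠ 0 := by omega
  have h2 : ¬ 0 < (-((n : ℤ) + 1)) := by omega
  have h3 : (- -((n : ℤ) + 1)).toNat = n + 1 := by omega
  simp only [vhat, if_neg h1, if_neg h2, h3]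

lemma vhat_conj (β : ℂ) (j : ℤ) : vhat (starRingEnd ℂ β) j = vhat β (-j) := by
  rcases lt_trichotomy j 0 with h | h | h
  · obtain ⟨n, rfl⟩ : ∃ n : ℕ, j = -((n : ℤ) + 1) := ⟨(-j - 1).toNat, by omega⟩
    rw [vhat_neg, neg_neg, vhat_pos]; simp
  · subst h; simp [vhat]
  · obtain ⟨n, rfl⟩ : ∃ n : ℕ, j = ((n : ℤ) + 1) := ⟨(j - 1).toNat, by omega⟩
    rw [vhat_neg, vhat_pos]

lemma uhat_mul (N : ℕ) (hN : 1 ≤ N) (β : ℂ) (j : ℤ) :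
    uhat N β ((N : ℤ) * j) = N * vhat β j := by
  have hN0 : (N : ℤ) ≠ 0 := by omega
  have hNp : (0 : ℤ) < N := by omega
  rcases lt_trichotomy j 0 with h | h | h
  · have h1 : (N : ℤ) * j < 0 := mul_neg_of_pos_of_neg hNp h
    have h3 : |(N : ℤ) * j| / N = -j := by
      rw [abs_of_neg h1, ← mul_neg, Int.mul_ediv_cancel_left _ hN0]
    simp only [uhat, vhat, if_neg h1.ne, if_neg h.ne, if_neg h1.not_gt, if_neg h.not_gt, h3,
      if_pos (dvd_mul_right _ _)]
    ring
  · subst h; simp [uhat, vhat]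
  · have h1 : 0 < (N : ℤ) * j := mul_pos hNp h
    simp only [uhat, vhat, if_neg h1.ne', if_neg h.ne', if_pos h1, if_pos h,
      if_pos (dvd_mul_right _ _), Int.mul_ediv_cancel_left _ hN0]
    ring

lemma uhat_not_dvd (N : ℕ) (β : ℂ) (k : ℤ) (h : ¬ (N : ℤ) ∣ k) : uhat N β k = 0 := by
  have h0 : k ≠ 0 := by rintro rfl; exact h (dvd_zero _)
  simp only [uhat, if_neg h0, if_neg h]

lemma hasSum_vhat_pos (β : ℂ) (hβ : ‖β‖ < 1) (n : ℕ) :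
    HasSum (fun j : ℤ => vhat β j * vhat β ((n : ℤ) + 1 - j))
      (2 * ((n : ℂ) + 1) * vhat β ((n : ℤ) + 1)) := by
  set c := starRingEnd ℂ β with hc
  have hcb : c * β = ((‖β‖ ^ 2 : ℝ) : ℂ) := by
    rw [hc, mul_comm, Complex.mul_conj, Complex.normSq_eq_norm_sq]
  have hr : ‖β‖ ^ 2 < 1 := by nlinarith [norm_nonneg β]
  have hnorm : ‖c * β‖ < 1 := by
    rw [hcb, Complex.norm_real, Real.norm_of_nonneg (by positivity)]; exact hr
  have hne : 1 - c * β ≠ 0 := by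
    intro h
    rw [← sub_eq_zero.mp h] at hnorm
    simp at hnorm
  have hv0 : vhat β 0 = (1 - 3 * (c * β)) / (1 - c * β) := by
    rw [hcb]; simp [vhat]
  have hgeo : HasSum (fun i : ℕ => 4 * β ^ (n + 1) * (c * β) * (c * β) ^ i)
      (4 * β ^ (n + 1) * (c * β) * (1 - c * β)⁻¹) :=
    (hasSum_geometric_of_norm_lt_one hnorm).mul_left _
  have hneg : HasSum (fun i : ℕ => vhat β (-((i : ℤ) + 1)) * vhat β ((n : ℤ) + 1 - -((i : ℤ) + 1)))
      (4 * β ^ (n + 1) * (c * β) * (1 - c * β)⁻¹) := by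
    convert hgeo using 2 with i
    rw [vhat_neg, show (n : ℤ) + 1 - -((i : ℤ) + 1) = ((n + 1 + i : ℕ) : ℤ) + 1 by push_cast; ring,
      vhat_pos, ← hc]
    ring
  have htail : HasSum (fun i : ℕ => vhat β ((i + (n + 2) : ℕ) : ℤ) *
        vhat β ((n : ℤ) + 1 - ((i + (n + 2) : ℕ) : ℤ)))
      (4 * β ^ (n + 1) * (c * β) * (1 - c * β)⁻¹) := by
    convert hgeo using 2 with i
    rw [show (n : ℤ) + 1 - ((i + (n + 2) : ℕ) : ℤ) = -((i : ℤ) + 1) by push_cast; ring,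
      show ((i + (n + 2) : ℕ) : ℤ) = ((n + 1 + i : ℕ) : ℤ) + 1 by push_cast; ring,
      vhat_neg, vhat_pos, ← hc]
    ring
  have hpos := (hasSum_nat_add_iff
    (f := fun i : ℕ => vhat β (i : ℤ) * vhat β ((n : ℤ) + 1 - (i : ℤ))) (n + 2)).mp htail
  have hfin : ∑ i ∈ Finset.range (n + 2), vhat β (i : ℤ) * vhat β ((n : ℤ) + 1 - (i : ℤ))
      = 4 * β ^ (n + 1) * n + 4 * β ^ (n + 1) * vhat β 0 := by
    rw [Finset.sum_range_succ, Finset.sum_range_succ']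
    have hmid : ∀ i ∈ Finset.range n,
        vhat β ((i + 1 : ℕ) : ℤ) * vhat β ((n : ℤ) + 1 - ((i + 1 : ℕ) : ℤ))
          = 4 * β ^ (n + 1) := by
      intro i hi
      obtain ⟨t, rfl⟩ : ∃ t, n = i + t + 1 :=
        ⟨n - i - 1, by have := Finset.mem_range.mp hi; omega⟩
      rw [show ((i + t + 1 : ℕ) : ℤ) + 1 - ((i + 1 : ℕ) : ℤ) = (t : ℤ) + 1 by push_cast; ring,
        show ((i + 1 : ℕ) : ℤ) = (i : ℤ) + 1 by push_cast; ring, vhat_pos, vhat_pos]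
      ring
    rw [Finset.sum_congr rfl hmid]
    have e1 : ((n + 1 : ℕ) : ℤ) = (n : ℤ) + 1 := by push_cast; ring
    simp only [e1, sub_self, Nat.cast_zero, sub_zero, vhat_pos, Finset.sum_const,
      Finset.card_range, nsmul_eq_mul]
    ring
  have key := HasSum.of_nat_of_neg_add_one
    (f := fun j : ℤ => vhat β j * vhat β ((n : ℤ) + 1 - j)) hpos hneg
  convert key using 1
  rw [hfin, vhat_pos, hv0]
  field_simp
  ring

lemma hasSum_vhat (β : ℂ) (hβ : ‖β‖ < 1) (m : ℤ) (hm : m ≠ 0) :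
    HasSum (fun j : ℤ => vhat β j * vhat β (m - j)) (2 * ((|m| : ℤ) : ℂ) * vhat β m) := by
  rcases lt_or_gt_of_ne hm with h | h
  · obtain ⟨n, rfl⟩ : ∃ n : ℕ, m = -((n : ℤ) + 1) := ⟨(-m - 1).toNat, by omega⟩
    have := hasSum_vhat_pos (starRingEnd ℂ β) (by simpa using hβ) n
    rw [← (Equiv.neg ℤ).hasSum_iff]
    rw [abs_neg, abs_of_nonneg (by omega)]
    convert this using 1
    · funext j
      simp only [Function.comp, Equiv.neg_apply, vhat_conj]
      congr 2
      ring
    · rw [vhat_conj]; push_cast; ring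
  · obtain ⟨n, rfl⟩ : ∃ n : ℕ, m = ((n : ℤ) + 1) := ⟨(m - 1).toNat, by omega⟩
    rw [abs_of_pos h]
    simpa using hasSum_vhat_pos β hβ n

lemma hasSum_uhat (N : ℕ) (hN : 1 ≤ N) (β : ℂ) (hβ : ‖β‖ < 1) (k : ℤ) (hk : k ≠ 0) :
    HasSum (fun l : ℤ => uhat N β l * uhat N β (k - l))
      (2 * (((|k| : ℤ) : ℂ) * uhat N β k)) := by
  by_cases hd : (N : ℤ) ∣ k
  · obtain ⟨m, rfl⟩ := hd
    have hm : m ≠ 0 := by rintro rfl; simp at hk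
    have hN0 : (N : ℤ) ≠ 0 := by omega
    have hinj : Function.Injective (fun j : ℤ => (N : ℤ) * j) := mul_right_injective₀ hN0
    rw [← hinj.hasSum_iff]
    · convert (hasSum_vhat β hβ m hm).mul_left ((N : ℂ) ^ 2) using 1
      · rfl
      · funext j
        simp only [Function.comp, ← mul_sub, uhat_mul N hN]
        ring
      · rw [uhat_mul N hN, abs_mul, Nat.abs_cast]; push_cast; ring
    · intro x hx
      rw [uhat_not_dvd N β x, zero_mul]
      rintro ⟨j, rfl⟩
      exact hx ⟨j, rfl⟩
  · rw [uhat_not_dvd N β k hd, mul_zero, mul_zero]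
    convert hasSum_zero using 1
    funext l
    by_cases hl : (N : ℤ) ∣ l
    · rw [uhat_not_dvd N β (k - l), mul_zero]
      intro h
      exact hd (by simpa using dvd_add h hl)
    · rw [uhat_not_dvd N β l hl, zero_mul]

/-- In Fourier variables, the `N`-hump stationary solution satisfies the
stationary Benjamin–Ono equation `Hu_xx - uu_x = 0`:
`(1/2)(û∗û)(k) = |k|·û(k)` for `k ≠ 0`. -/
theorem benjamin_ono_stationary_convolution (N : ℕ) (hN : 1 ≤ N) (β : ℂ)
    (hβ : ‖β‖ < 1) (k : ℤ) (hk : k ≠ 0) :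
    Summable (fun l : ℤ => ‖uhat N β l * uhat N β (k - l)‖) ∧
    (1 / 2 : ℂ) * ∑' l : ℤ, uhat N β l * uhat N β (k - l)
      = ((|k| : ℤ) : ℂ) * uhat N β k := by
  have h := hasSum_uhat N hN β hβ k hk
  refine ⟨h.summable.norm, ?_⟩
  rw [h.tsum_eq]
  ring
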